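/- Let M = ⟨x, y⟩ be a metabelian, 2-generator finite nilpotent group, and let M₂ = [M, M] be its derived subgroup. Then for all u, v ∈ M₂ there is an automorphism of M sending x to x·u and y to y·v. -/

import Mathlib

open scoped commutatorElement

/-- `d` is a crossed homomorphism into the derived subgroup. -/
def IsDer {M : Type*} [Group M] (d : M → M) : Prop :=
  (∀ a, d a ∈ commutator M) ∧ ∀ a b, d (a * b) = b⁻¹ * d a * b * d b

theorem der_mul {M : Type*} [Group M]
    (hmeta : ∀ a ∈ commutator M, ∀ b ∈ commutator M, a * b = b * a)
    {d e : M → M} (hd : IsDer d) (he : IsDer e) : IsDer (fun w => d w * e w) := by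
  refine ⟨fun a => mul_mem (hd.1 a) (he.1 a), fun a b => ?_⟩
  have h := hmeta _ (hd.1 b) (b⁻¹ * e a * b) (by
    simpa using (inferInstance : (commutator M).Normal).conj_mem _ (he.1 a) b⁻¹)
  simp only [hd.2, he.2]
  calc b⁻¹ * d a * b * d b * (b⁻¹ * e a * b * e b)
      = b⁻¹ * d a * b * (d b * (b⁻¹ * e a * b)) * e b := by group
    _ = _ := by rw [h]; group

theorem der_inv {M : Type*} [Group M]
    (hmeta : ∀ a ∈ commutator M, ∀ b ∈ commutator M, a * b = b * a)
    {d : M → M} (hd : IsDer d) : IsDer (fun w => (d w)⁻¹) := by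
  refine ⟨fun a => inv_mem (hd.1 a), fun a b => ?_⟩
  have h := hmeta _ (inv_mem (hd.1 b)) (b⁻¹ * (d a)⁻¹ * b) (by
    simpa using (inferInstance : (commutator M).Normal).conj_mem _ (inv_mem (hd.1 a)) b⁻¹)
  simp only [hd.2]
  calc (b⁻¹ * d a * b * d b)⁻¹ = (d b)⁻¹ * (b⁻¹ * (d a)⁻¹ * b) := by group
    _ = _ := by rw [h]

theorem der_conj {M : Type*} [Group M]
    (hmeta : ∀ a ∈ commutator M, ∀ b ∈ commutator M, a * b = b * a)
    {d : M → M} (hd : IsDer d) (g : M) : IsDer (fun w => g * d w * g⁻¹) := by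
  have hn : (commutator M).Normal := inferInstance
  refine ⟨fun a => hn.conj_mem _ (hd.1 a) g, fun a b => ?_⟩
  simp only [hd.2]
  have h2 : g * (b⁻¹ * d a * b) * g⁻¹ = b⁻¹ * (g * d a * g⁻¹) * b := by
    have h7 := hmeta _ (hd.1 a) (b * g⁻¹ * b⁻¹ * g) (by
      simpa [commutatorElement_def, commutator_def] using Subgroup.commutator_mem_commutator (Subgroup.mem_top b) (Subgroup.mem_top g⁻¹))
    calc g * (b⁻¹ * d a * b) * g⁻¹
        = g * b⁻¹ * (d a * (b * g⁻¹ * b⁻¹ * g)) * g⁻¹ * b := by group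
      _ = _ := by rw [h7]; group
  calc g * (b⁻¹ * d a * b * d b) * g⁻¹
      = g * (b⁻¹ * d a * b) * g⁻¹ * (g * d b * g⁻¹) := by group
    _ = _ := by rw [h2]

theorem der_comm {M : Type*} [Group M] (y : M) : IsDer (fun w : M => w⁻¹ * y⁻¹ * w * y) := by
  refine ⟨fun a => ?_, fun a b => by group⟩
  simpa [commutatorElement_def, commutator_def] using
    Subgroup.commutator_mem_commutator (Subgroup.mem_top a⁻¹) (Subgroup.mem_top y⁻¹)

theorem comm_le {M : Type*} [Group M] (x y : M) (hgen : Subgroup.closure {x, y} = ⊤)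
    (S : Subgroup M) [S.Normal] (h : x⁻¹ * y⁻¹ * x * y ∈ S) : commutator M ≤ S := by
  have hxy : (x : M ⧸ S) * y = y * x := by
    rw [← QuotientGroup.mk_mul, ← QuotientGroup.mk_mul, eq_comm, QuotientGroup.eq]
    simpa [mul_assoc] using h
  have key : ∀ z : M, (z : M ⧸ S) * x = x * z → (z : M ⧸ S) * y = y * z →
      ∀ w : M, (z : M ⧸ S) * w = w * z := by
    intro z hx hy w
    have hw : w ∈ Subgroup.closure {x, y} := hgen ▸ Subgroup.mem_top w
    induction hw using Subgroup.closure_induction with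
    | mem a ha => rcases ha with rfl | rfl <;> assumption
    | one => simp
    | mul a b _ _ ha hb => exact Commute.mul_right (a := (z : M ⧸ S)) ha hb
    | inv a _ ha => exact Commute.inv_right (a := (z : M ⧸ S)) ha
  have kx := key x rfl hxy
  have ky := key y hxy.symm rfl
  rw [commutator_def, Subgroup.commutator_le]
  intro a _ b _
  have := key a (kx a).symm (ky a).symm b
  rw [← QuotientGroup.eq_one_iff]
  change ⁅(a : M ⧸ S), (b : M ⧸ S)⁆ = 1
  rwa [commutatorElement_eq_one_iff_mul_comm]

theorem exists_der {M : Type*} [Group M] (x y : M) (hgen : Subgroup.closure {x, y} = ⊤)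
    (hmeta : ∀ a ∈ commutator M, ∀ b ∈ commutator M, a * b = b * a)
    (u : M) (hu : u ∈ commutator M) : ∃ d : M → M, IsDer d ∧ d x = u ∧ d y = 1 := by
  let S : Subgroup M :=
    { carrier := {u | ∃ d : M → M, IsDer d ∧ d x = u ∧ d y = 1}
      one_mem' := ⟨fun _ => 1, ⟨fun _ => one_mem _, by simp⟩, rfl, rfl⟩
      mul_mem' := by
        rintro _ _ ⟨d, hd, rfl, hd'⟩ ⟨e, he, rfl, he'⟩
        exact ⟨_, der_mul hmeta hd he, rfl, by simp [hd', he']⟩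
      inv_mem' := by
        rintro _ ⟨d, hd, rfl, hd'⟩
        exact ⟨_, der_inv hmeta hd, rfl, by simp [hd']⟩ }
  have : S.Normal := ⟨by
    rintro _ ⟨d, hd, rfl, hd'⟩ g
    exact ⟨_, der_conj hmeta hd g, rfl, by simp [hd']⟩⟩
  exact comm_le x y hgen S ⟨_, der_comm y, rfl, by group⟩ hu

theorem eq_top_of_sup {M : Type*} [Group M] [Finite M] [Group.IsNilpotent M]
    (K : Subgroup M) (h : K ⊔ commutator M = ⊤) : K = ⊤ := by
  by_contra hK
  obtain ⟨H, hH, hKH⟩ := (eq_top_or_exists_le_coatom K).resolve_left hK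
  have hn : H.Normal := Subgroup.NormalizerCondition.normal_of_coatom H
    Group.normalizerCondition_of_isNilpotent hH
  have hnt : Nontrivial (M ⧸ H) := QuotientGroup.nontrivial_iff.2 hH.1
  have hlt := IsSolvable.commutator_lt_top_of_nontrivial (M ⧸ H)
  apply hlt.ne
  have h1 : (commutator M).map (QuotientGroup.mk' H) = commutator (M ⧸ H) := by
    rw [commutator_def, Subgroup.map_commutator, commutator_def,
      Subgroup.map_top_of_surjective _ (QuotientGroup.mk'_surjective H)]
  have h2 : H ⊔ commutator M = ⊤ := top_le_iff.1 (h ▸ sup_le_sup_right hKH _)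
  have h3 := congrArg (Subgroup.map (QuotientGroup.mk' H)) h2
  rwa [Subgroup.map_sup, h1, QuotientGroup.map_mk'_self, bot_sup_eq,
    Subgroup.map_top_of_surjective _ (QuotientGroup.mk'_surjective H)] at h3



/-- **Caranti–Scoppola.** Let `M = ⟨x, y⟩` be a metabelian, 2-generator finite
nilpotent group, and let `M₂ = [M, M]` be its derived subgroup. Then for all
`u, v ∈ M₂` there is an automorphism of `M` sending `x` to `x * u` and `y` to
`y * v`. -/
theorem stmt6 {M : Type*} [Group M] [Finite M] [Group.IsNilpotent M]
    (x y : M) (hgen : Subgroup.closure {x, y} = ⊤)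
    (hmeta : ∀ a ∈ commutator M, ∀ b ∈ commutator M, a * b = b * a)
    (u v : M) (hu : u ∈ commutator M) (hv : v ∈ commutator M) :
    ∃ φ : MulAut M, φ x = x * u ∧ φ y = y * v := by
  obtain ⟨d, hd, hdx, hdy⟩ := exists_der x y hgen hmeta u hu
  obtain ⟨e, he, hey, hex⟩ := exists_der y x (by rwa [Set.pair_comm]) hmeta v hv
  have hf := der_mul hmeta hd he
  generalize hfe : (fun w => d w * e w) = f at hf
  have hfx : f x = u := by rw [← hfe]; simp [hdx, hex]
  have hfy : f y = v := by rw [← hfe]; simp [hdy, hey]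
  let φ : M →* M := MonoidHom.mk' (fun w => w * f w) (fun a b => by
    rw [hf.2]; group)
  have hr : φ.range = ⊤ := by
    apply eq_top_of_sup
    rw [eq_top_iff]
    intro w _
    have h : w = φ w * (f w)⁻¹ := by simp [φ]
    rw [h]
    exact Subgroup.mul_mem_sup ⟨w, rfl⟩ (inv_mem (hf.1 w))
  have hs : Function.Surjective φ := MonoidHom.range_eq_top.1 hr
  have hb : Function.Bijective φ := ⟨Finite.injective_iff_surjective.2 hs, hs⟩
  refine ⟨MulEquiv.ofBijective φ hb, ?_, ?_⟩
  · change x * f x = _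
    rw [hfx]
  · change y * f y = _
    rw [hfy]
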